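/- Let n ≥ 2 and fix signs ε_1,…,ε_n ∈ {1,−1}. There is a constant C > 0 such that for every unit vector e ∈ S^{n−1} and every φ ∈ L²(ℝⁿ), the free evolution satisfies the smoothing estimate ‖D^{1/2}_{e_±} W_±(t)φ‖_{L^{∞,2}_e} ≤ C‖φ‖_{L²}, where the left-hand side is the L^{∞,2}_e norm of the space-time function (t,x) ↦ (D^{1/2}_{e_±} W_±(t)φ)(x). -/

import Mathlib

open MeasureTheory Complex Filter
open scoped FourierTransform RealInnerProductSpace ENNReal NNReal Topology

noncomputable section

namespace DNLS

/-- Euclidean space ℝⁿ. -/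
abbrev Eucl (n : ℕ) := EuclideanSpace ℝ (Fin n)

/-- The quadratic symbol `|ξ|²_± = Σ εᵢ ξᵢ²`. -/
def quadSym {n : ℕ} (ε : Fin n → ℝ) (ξ : Eucl n) : ℝ := ∑ i, ε i * (ξ i) ^ 2

/-- The signed vector `e_± = (ε₁e₁, …, εₙeₙ)`. -/
def epm {n : ℕ} (ε : Fin n → ℝ) (e : Eucl n) : Eucl n := WithLp.toLp 2 (fun i => ε i * e i)

/-- Fourier multiplier operator with symbol `m`. -/
def mulOp {n : ℕ} (m : Eucl n → ℂ) (f : Eucl n → ℂ) : Eucl n → ℂ :=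
  𝓕⁻ (fun ξ => m ξ * 𝓕 f ξ)

/-- The propagator `W_±(t)`, with `(W_±(t)φ)^(ξ) = e^{-it|ξ|²_±} φ̂(ξ)`. -/
def prop {n : ℕ} (ε : Fin n → ℝ) (t : ℝ) (φ : Eucl n → ℂ) : Eucl n → ℂ :=
  mulOp (fun ξ => Complex.exp (-Complex.I * t * quadSym ε ξ)) φ

/-- Fourier multiplier operator acting in the space variable of a space-time function. -/
def mulOpT {n : ℕ} (m : Eucl n → ℂ) (u : ℝ × Eucl n → ℂ) : ℝ × Eucl n → ℂ :=
  fun p => mulOp m (fun y => u (p.1, y)) p.2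

/-- Hypotheses on the bump function χ : even, smooth, compactly supported in (-2,2),
equal to one on [-1,1]. -/
structure IsBump (χ : ℝ → ℝ) : Prop where
  smooth : ∀ k : ℕ, ContDiff ℝ k χ
  even : ∀ s, χ (-s) = χ s
  supp : ∀ s, 2 ≤ |s| → χ s = 0
  one : ∀ s, |s| ≤ 1 → χ s = 1

/-- `ψ(s) = χ(|s|) - χ(2|s|)`. -/
def psiR (χ : ℝ → ℝ) (s : ℝ) : ℝ := χ |s| - χ (2 * |s|)

/-- `ψ_{≥k}(s) = Σ_{m ≥ k} ψ(2^{-m} s)`. -/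
def psiGe (χ : ℝ → ℝ) (k : ℤ) (s : ℝ) : ℝ :=
  ∑' m : ℤ, if k ≤ m then psiR χ ((2 : ℝ) ^ (-m) * s) else 0

/-- Littlewood–Paley projection `P_j`. -/
def proj {n : ℕ} (χ : ℝ → ℝ) (j : ℤ) (f : Eucl n → ℂ) : Eucl n → ℂ :=
  mulOp (fun ξ => (psiR χ ((2 : ℝ) ^ (-j) * ‖ξ‖) : ℂ)) f

/-- Low-frequency projection `P_{≤0} = I - Σ_{j≥1} P_j`. -/
def lowProj {n : ℕ} (χ : ℝ → ℝ) (f : Eucl n → ℂ) : Eucl n → ℂ :=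
  mulOp (fun ξ => ((1 - psiGe χ 1 ‖ξ‖ : ℝ) : ℂ)) f

/-- Directional frequency cutoff `Q^{e}_{j,l}` with symbol `ψ_{≥ j-l}(ξ·e)`. -/
def qproj {n : ℕ} (χ : ℝ → ℝ) (e : Eucl n) (j l : ℤ) (f : Eucl n → ℂ) : Eucl n → ℂ :=
  mulOp (fun ξ => ((psiGe χ (j - l) (inner ℝ ξ e : ℝ) : ℝ) : ℂ)) f

/-- `P_j` acting in the space variable of a space-time function. -/
def projT {n : ℕ} (χ : ℝ → ℝ) (j : ℤ) (u : ℝ × Eucl n → ℂ) : ℝ × Eucl n → ℂ :=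
  fun p => proj χ j (fun y => u (p.1, y)) p.2

/-- `P_{≤0}` acting in the space variable of a space-time function. -/
def lowProjT {n : ℕ} (χ : ℝ → ℝ) (u : ℝ × Eucl n → ℂ) : ℝ × Eucl n → ℂ :=
  fun p => lowProj χ (fun y => u (p.1, y)) p.2

/-- `Q^{e}_{j,l}` acting in the space variable of a space-time function. -/
def qprojT {n : ℕ} (χ : ℝ → ℝ) (e : Eucl n) (j l : ℤ) (u : ℝ × Eucl n → ℂ) :
    ℝ × Eucl n → ℂ :=
  fun p => qproj χ e j l (fun y => u (p.1, y)) p.2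

/-- The hyperplane `P_e = {ξ : ξ·e = 0}`. -/
def hyperplane {n : ℕ} (e : Eucl n) : Submodule ℝ (Eucl n) := (ℝ ∙ e)ᗮ

/-- Inner part of the anisotropic norm: the `L^q` norm over `P_e × ℝ` of
`(t,v) ↦ u(t, re + v)`. -/
def innerQ {n : ℕ} (q : ℝ≥0∞) (e : Eucl n) (u : ℝ × Eucl n → ℂ) (r : ℝ) : ℝ≥0∞ :=
  eLpNorm (fun tv : ℝ × (hyperplane e) => u (tv.1, r • e + (tv.2 : Eucl n))) q volume

/-- The anisotropic norm `‖u‖_{L^{p,q}_e}`. -/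
def aniNorm {n : ℕ} (p q : ℝ≥0∞) (e : Eucl n) (u : ℝ × Eucl n → ℂ) : ℝ≥0∞ :=
  if p = ∞ then essSup (innerQ q e u) volume
  else (∫⁻ r : ℝ, innerQ q e u r ^ p.toReal) ^ (1 / p.toReal)

/-- The mixed space-time norm `‖u‖_{L^q_t L^r_x}`. -/
def mixNorm {n : ℕ} (q r : ℝ≥0∞) (u : ℝ × Eucl n → ℂ) : ℝ≥0∞ :=
  if q = ∞ then essSup (fun t => eLpNorm (fun x => u (t, x)) r volume) volume
  else (∫⁻ t : ℝ, eLpNorm (fun x => u (t, x)) r volume ^ q.toReal) ^ (1 / q.toReal)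

/-- `2^a` as an extended nonnegative real. -/
def tp (a : ℝ) : ℝ≥0∞ := ENNReal.ofReal ((2 : ℝ) ^ a)

/-- Homogeneous Besov norm `‖φ‖_{Ḃ^s_{2,1}}`. -/
def homBesov {n : ℕ} (χ : ℝ → ℝ) (s : ℝ) (φ : Eucl n → ℂ) : ℝ≥0∞ :=
  ∑' j : ℤ, tp (s * j) * eLpNorm (proj χ j φ) 2 volume

/-- Inhomogeneous Besov norm `‖φ‖_{B^s_{2,1}}`. -/
def besov {n : ℕ} (χ : ℝ → ℝ) (s : ℝ) (φ : Eucl n → ℂ) : ℝ≥0∞ :=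
  eLpNorm (lowProj χ φ) 2 volume
    + ∑' j : ℕ, tp (s * (j + 1)) * eLpNorm (proj χ (j + 1) φ) 2 volume

/-- The supremum over unit vectors, auxiliary notation. -/
def sphSup {n : ℕ} (g : Eucl n → ℝ≥0∞) : ℝ≥0∞ := ⨆ (e : Eucl n) (_ : ‖e‖ = 1), g e

/-- `‖P_j u‖_{M^m_j} = 2^{-(n/2-1/(m-1))j} sup_e ‖P_j u‖_{L^{m-1,∞}_e}`. -/
def MmJ {n : ℕ} (χ : ℝ → ℝ) (m : ℕ) (j : ℤ) (u : ℝ × Eucl n → ℂ) : ℝ≥0∞ :=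
  tp (-((n : ℝ) / 2 - 1 / ((m : ℝ) - 1)) * j)
    * sphSup (fun e => aniNorm ((m : ℝ≥0∞) - 1) ∞ e (projT χ j u))

/-- `‖P_j u‖_{S_j} = 2^{j/2} sup_e ‖P_j Q^{e_±}_{j,20} u‖_{L^{∞,2}_e}`. -/
def SJ {n : ℕ} (ε : Fin n → ℝ) (χ : ℝ → ℝ) (j : ℤ) (u : ℝ × Eucl n → ℂ) : ℝ≥0∞ :=
  tp ((j : ℝ) / 2)
    * sphSup (fun e => aniNorm ∞ 2 e (projT χ j (qprojT χ (epm ε e) j 20 u)))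

/-- `‖P_j u‖_{T_j} = ‖P_j u‖_{L^∞_t L²_x}`. -/
def TJ {n : ℕ} (χ : ℝ → ℝ) (j : ℤ) (u : ℝ × Eucl n → ℂ) : ℝ≥0∞ :=
  mixNorm ∞ 2 (projT χ j u)

/-- `‖P_j u‖_{Y^m_j}`. -/
def YmJ {n : ℕ} (ε : Fin n → ℝ) (χ : ℝ → ℝ) (m : ℕ) (j : ℤ) (u : ℝ × Eucl n → ℂ) : ℝ≥0∞ :=
  MmJ χ m j u + SJ ε χ j u + TJ χ j u

/-- The homogeneous resolution norm `‖u‖_{Ż^σ_{2,1}}`. -/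
def Zhom {n : ℕ} (ε : Fin n → ℝ) (χ : ℝ → ℝ) (m : ℕ) (σ : ℝ) (u : ℝ × Eucl n → ℂ) : ℝ≥0∞ :=
  ∑' j : ℤ, tp (σ * j) * YmJ ε χ m j u

/-- `N_j`-norm of a function: `2^{-j/2} sup_e ‖f‖_{L^{1,2}_e}`. -/
def NJraw {n : ℕ} (j : ℤ) (f : ℝ × Eucl n → ℂ) : ℝ≥0∞ :=
  tp (-(j : ℝ) / 2) * sphSup (fun e => aniNorm 1 2 e f)

/-- `‖P_j u‖_{N_j}`. -/
def NJ {n : ℕ} (χ : ℝ → ℝ) (j : ℤ) (u : ℝ × Eucl n → ℂ) : ℝ≥0∞ :=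
  NJraw j (projT χ j u)

/-- The homogeneous nonlinear norm `‖F‖_{Ṅ^σ_{2,1}}`. -/
def Nhom {n : ℕ} (χ : ℝ → ℝ) (σ : ℝ) (F : ℝ × Eucl n → ℂ) : ℝ≥0∞ :=
  ∑' j : ℤ, tp (σ * j) * NJ χ j F

/-- `‖P_j u‖_{T̃_j} = ‖P_j u‖_{L^∞_t L²_x} + ‖P_j u‖_{L^{2+4/n}_{t,x}}`. -/
def TtilJ {n : ℕ} (χ : ℝ → ℝ) (j : ℤ) (u : ℝ × Eucl n → ℂ) : ℝ≥0∞ :=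
  mixNorm ∞ 2 (projT χ j u)
    + eLpNorm (projT χ j u) (ENNReal.ofReal (2 + 4 / (n : ℝ))) volume

/-- `‖P_j u‖_{M̃_j} = sup_{p ∈ ℤ, p ≥ 2, np ≥ 6} sup_e 2^{(n/2-1/p)j}‖P_j u‖_{L^{p,∞}_e}`. -/
def MtilJ {n : ℕ} (χ : ℝ → ℝ) (j : ℤ) (u : ℝ × Eucl n → ℂ) : ℝ≥0∞ :=
  ⨆ (p : ℕ) (_ : 2 ≤ p ∧ 6 ≤ n * p),
    sphSup (fun e => tp (((n : ℝ) / 2 - 1 / (p : ℝ)) * j) * aniNorm (p : ℝ≥0∞) ∞ e (projT χ j u))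

/-- `‖P_j u‖_{Ỹ_j}`. -/
def YtilJ {n : ℕ} (ε : Fin n → ℝ) (χ : ℝ → ℝ) (j : ℤ) (u : ℝ × Eucl n → ℂ) : ℝ≥0∞ :=
  MtilJ χ j u + SJ ε χ j u + TtilJ χ j u

/-- The inhomogeneous resolution norm `‖u‖_{Z̃^σ_{2,1}}`. -/
def Ztil {n : ℕ} (ε : Fin n → ℝ) (χ : ℝ → ℝ) (σ : ℝ) (u : ℝ × Eucl n → ℂ) : ℝ≥0∞ :=
  (∑' j : ℤ, if j ≤ 0 then YtilJ ε χ j u ^ 2 else 0) ^ ((1 : ℝ) / 2)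
    + ∑' j : ℤ, if 1 ≤ j then tp (σ * j) * YtilJ ε χ j u else 0

/-- `‖f‖_{Ñ_j}`: infimum over decompositions `f = v + w`. -/
def NtilJraw {n : ℕ} (j : ℤ) (f : ℝ × Eucl n → ℂ) : ℝ≥0∞ :=
  ⨅ (vw : (ℝ × Eucl n → ℂ) × (ℝ × Eucl n → ℂ)) (_ : f = vw.1 + vw.2),
    NJraw j vw.1 + eLpNorm vw.2 (ENNReal.ofReal ((2 * (n : ℝ) + 4) / ((n : ℝ) + 4))) volume

/-- The inhomogeneous nonlinear norm `‖F‖_{Ñ^σ_{2,1}}`. -/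
def Ntil {n : ℕ} (χ : ℝ → ℝ) (σ : ℝ) (F : ℝ × Eucl n → ℂ) : ℝ≥0∞ :=
  (∑' j : ℤ, if j ≤ 0 then NtilJraw j (projT χ j F) ^ 2 else 0) ^ ((1 : ℝ) / 2)
    + ∑' j : ℤ, if 1 ≤ j then tp (σ * j) * NtilJraw j (projT χ j F) else 0

/-- `k`-th spatial partial derivative of a space-time function. -/
def pd {n : ℕ} (k : ℕ) (u : ℝ × Eucl n → ℂ) (p : ℝ × Eucl n) : ℂ :=
  if h : k < n then fderiv ℝ (fun y => u (p.1, y)) p.2 (EuclideanSpace.single ⟨k, h⟩ (1 : ℝ))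
  else 0

/-- The retarded Duhamel integral `∫_0^t W_±(t-s) G(s) ds`. -/
def duhamel {n : ℕ} (ε : Fin n → ℝ) (G : ℝ × Eucl n → ℂ) (p : ℝ × Eucl n) : ℂ :=
  ∫ s in (0 : ℝ)..p.1, prop ε (p.1 - s) (fun y => G (s, y)) p.2

/-- Admissible Strichartz pair: `2/q = n(1/2 - 1/r)`, `q, r ≥ 2`, and `q ≠ 2` when `n = 2`. -/
def Admissible (n : ℕ) (q r : ℝ) : Prop :=
  2 / q = (n : ℝ) * (1 / 2 - 1 / r) ∧ 2 ≤ q ∧ 2 ≤ r ∧ (n = 2 → q ≠ 2)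

/-- Value of a power series with coefficients `c` at `z`. -/
def polyVal {d : ℕ} (c : (Fin d →₀ ℕ) → ℂ) (z : Fin d → ℂ) : ℂ :=
  ∑' β : Fin d →₀ ℕ, c β * ∏ i, z i ^ β i

/-- The argument vector `(u, ū, ∇u, ∇ū)` of the general nonlinearity. -/
def nlArg {n : ℕ} (u : ℝ × Eucl n → ℂ) (p : ℝ × Eucl n) (i : Fin (2 * n + 2)) : ℂ :=
  if (i : ℕ) = 0 then u p
  else if (i : ℕ) = 1 then starRingEnd ℂ (u p)
  else if (i : ℕ) < n + 2 then pd ((i : ℕ) - 2) u p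
  else pd ((i : ℕ) - (n + 2)) (fun q => starRingEnd ℂ (u q)) p

/-- The argument vector `(∇u, ∇ū)` of a nonlinearity in `2n` variables. -/
def gradArg {n : ℕ} (u : ℝ × Eucl n → ℂ) (p : ℝ × Eucl n) (i : Fin (2 * n)) : ℂ :=
  if (i : ℕ) < n then pd (i : ℕ) u p
  else pd ((i : ℕ) - n) (fun q => starRingEnd ℂ (u q)) p

end DNLS
open DNLS

namespace DNLS

section Plancherel

variable {E : Type*} [NormedAddCommGroup E] [InnerProductSpace ℝ E] [FiniteDimensional ℝ E]
  [MeasurableSpace E] [BorelSpace E]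

lemma continuous_fourier_of_integrable {f : E → ℂ} (hf : Integrable f) : Continuous (𝓕 f) :=
  VectorFourier.fourierIntegral_continuous (μ := volume) Real.continuous_fourierChar
    (L := innerₗ E) continuous_inner hf

lemma fourier_eq_zero_of_not_integrable {f : E → ℂ} (hf : ¬ Integrable f) : 𝓕 f = 0 := by
  funext x
  rw [Real.fourier_eq]
  exact integral_undef fun h => hf ((Real.fourierIntegral_convergent_iff x).1 h)

lemma fourierInv_eq_zero_of_not_integrable {f : E → ℂ} (hf : ¬ Integrable f) : 𝓕⁻ f = 0 := by
  funext x
  rw [Real.fourierInv_eq_fourier_neg, fourier_eq_zero_of_not_integrable hf]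
  rfl

/-- The Fourier integral of a function in `L¹ ∩ L²` represents its `L²` Fourier transform. -/
lemma fourier_ae_eq_fourier_toLp {f : E → ℂ} (hf : Integrable f) (hf2 : MemLp f 2 volume) :
    𝓕 f =ᵐ[volume] (𝓕 (hf2.toLp f) : Lp (α := E) ℂ 2 volume) := by
  refine ae_eq_of_integral_contDiff_smul_eq
    (continuous_fourier_of_integrable hf).locallyIntegrable
    ((Lp.memLp _).locallyIntegrable (by norm_num)) fun g hg hgs => ?_
  let ψ : SchwartzMap E ℂ :=
    (hgs.comp_left (g := Complex.ofRealCLM) (by simp)).toSchwartzMap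
      (Complex.ofRealCLM.contDiff.comp hg)
  have hψ : ∀ x, ψ x = (g x : ℂ) := fun x => rfl
  have h := congrArg (fun T => T ψ) (Lp.fourier_toTemperedDistribution_eq (hf2.toLp f))
  simp only [TemperedDistribution.fourier_apply, Lp.toTemperedDistribution_apply] at h
  have hflip := VectorFourier.integral_fourierIntegral_smul_eq_flip (L := innerₗ E)
    (μ := volume) (ν := volume) Real.continuous_fourierChar continuous_inner ψ.integrable hf
  rw [flip_innerₗ] at hflip
  calc ∫ x, g x • 𝓕 f x = ∫ x, ψ x • 𝓕 f x := by simp [hψ]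
    _ = ∫ x, 𝓕 (ψ : E → ℂ) x • f x := hflip.symm
    _ = ∫ x, (𝓕 ψ) x • (hf2.toLp f) x := by
      refine integral_congr_ae ?_
      filter_upwards [hf2.coeFn_toLp] with x hx
      rw [hx, SchwartzMap.fourier_coe]
    _ = _ := by rw [h]; simp [hψ]

/-- Plancherel's inequality for the Fourier integral of an integrable function. -/
lemma eLpNorm_fourier_le {f : E → ℂ} (hf : Integrable f) :
    eLpNorm (𝓕 f) 2 volume ≤ eLpNorm f 2 volume := by
  by_cases hf2 : MemLp f 2 volume
  · rw [eLpNorm_congr_ae (fourier_ae_eq_fourier_toLp hf hf2), ← Lp.enorm_def, enorm_eq_nnnorm,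
      ← ENNReal.ofReal_coe_nnreal, coe_nnnorm, Lp.norm_fourier_eq, ← coe_nnnorm,
      ENNReal.ofReal_coe_nnreal, ← enorm_eq_nnnorm, Lp.enorm_def,
      eLpNorm_congr_ae hf2.coeFn_toLp]
  · have : eLpNorm f 2 volume = ∞ := by
      by_contra h
      exact hf2 ⟨hf.1, lt_top_iff_ne_top.2 h⟩
    rw [this]
    exact le_top

/-- An oscillatory integral over `s` with phase `Φ` is the Fourier transform of the integrable
density obtained from the change of variables `y = Φ x`. -/
lemma exists_fourier_eq_oscillatory {Φ : E → E} {Φ' : E → E →L[ℝ] E} {s : Set E}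
    (hs : MeasurableSet s) (hΦ : ∀ x ∈ s, HasFDerivWithinAt Φ (Φ' x) s x) (hinj : s.InjOn Φ)
    (hdet : ∀ x ∈ s, (Φ' x).det ≠ 0) {H : E → ℂ} (hH : IntegrableOn H s) :
    ∃ F : E → ℂ, Integrable F ∧
      (∀ z, 𝓕 F z = ∫ x in s, Real.fourierChar (-inner ℝ (Φ x) z) • H x) ∧
      ∫⁻ y, ‖F y‖ₑ ^ 2 = ∫⁻ x in s, ‖H x‖ₑ ^ 2 / ENNReal.ofReal |(Φ' x).det| := by
  let G : E → ℂ := fun y =>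
    |(Φ' (Function.invFunOn Φ s y)).det|⁻¹ • H (Function.invFunOn Φ s y)
  have hG : ∀ x ∈ s, G (Φ x) = |(Φ' x).det|⁻¹ • H x := fun x hx => by
    simp only [G, hinj.leftInvOn_invFunOn hx]
  have himg : MeasurableSet (Φ '' s) := measurable_image_of_fderivWithin hs hΦ hinj
  have hcancel : ∀ x ∈ s, |(Φ' x).det| • G (Φ x) = H x := fun x hx => by
    rw [hG x hx, smul_smul, mul_inv_cancel₀ (abs_ne_zero.2 (hdet x hx)), one_smul]
  refine ⟨(Φ '' s).indicator G, ?_, fun z => ?_, ?_⟩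
  · rw [integrable_indicator_iff himg,
      integrableOn_image_iff_integrableOn_abs_det_fderiv_smul volume hs hΦ hinj]
    exact hH.congr_fun (fun x hx => (hcancel x hx).symm) hs
  · rw [Real.fourier_eq]
    have : ∀ v, Real.fourierChar (-inner ℝ v z) • (Φ '' s).indicator G v
        = (Φ '' s).indicator (fun v => Real.fourierChar (-inner ℝ v z) • G v) v := fun v => by
      by_cases hv : v ∈ Φ '' s <;> simp [hv]
    simp_rw [this]
    rw [integral_indicator himg, integral_image_eq_integral_abs_det_fderiv_smul volume hs hΦ hinj]
    refine setIntegral_congr_fun hs fun x hx => ?_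
    rw [smul_comm, hcancel x hx]
  · have : ∀ y, ‖(Φ '' s).indicator G y‖ₑ ^ 2 = (Φ '' s).indicator (fun y => ‖G y‖ₑ ^ 2) y :=
      fun v => by by_cases hv : v ∈ Φ '' s <;> simp [hv]
    simp_rw [this]
    rw [lintegral_indicator himg, lintegral_image_eq_lintegral_abs_det_fderiv_mul volume hs hΦ hinj]
    refine setLIntegral_congr_fun hs fun x hx => ?_
    have hpos : 0 < |(Φ' x).det| := abs_pos.2 (hdet x hx)
    have h0 : ENNReal.ofReal |(Φ' x).det| ≠ 0 := (ENNReal.ofReal_pos.2 hpos).ne'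
    rw [hG x hx, enorm_smul, Real.enorm_of_nonneg (inv_nonneg.2 hpos.le),
      ENNReal.ofReal_inv_of_pos hpos, mul_pow, ← mul_assoc, pow_two, ← mul_assoc,
      ENNReal.mul_inv_cancel h0 ENNReal.ofReal_ne_top, one_mul, mul_comm, div_eq_mul_inv]

end Plancherel

section Hyperplane

variable {n : ℕ}

/-- The decomposition `ℝⁿ = ℝe ⊕ P_e` preserves volume. -/
lemma measurePreserving_smul_add_hyperplane {e : Eucl n} (he : ‖e‖ = 1) :
    MeasurePreserving (fun tv : ℝ × hyperplane e => tv.1 • e + (tv.2 : Eucl n))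
      volume volume := by
  have h1 : MeasurePreserving
      (Prod.map (LinearIsometryEquiv.toSpanUnitSingleton (𝕜 := ℝ) e he)
        (id : hyperplane e → hyperplane e)) volume volume :=
    (LinearIsometryEquiv.measurePreserving _).prod (MeasurePreserving.id _)
  have h2 := (WithLp.volume_preserving_toLp (ℝ ∙ e) (hyperplane e)).comp h1
  have h3 := ((ℝ ∙ e).orthogonalDecomposition.symm.measurePreserving).comp h2
  have hfun : (fun tv : ℝ × hyperplane e => tv.1 • e + (tv.2 : Eucl n)) =
      (ℝ ∙ e).orthogonalDecomposition.symm ∘ WithLp.toLp 2 ∘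
        Prod.map (LinearIsometryEquiv.toSpanUnitSingleton (𝕜 := ℝ) e he) id := by
    rfl
  rw [hfun]
  exact h3

end Hyperplane

section Phase

variable {n : ℕ} (ε : Fin n → ℝ)

lemma inner_epm_comm (x y : Eucl n) : inner ℝ x (epm ε y) = inner ℝ y (epm ε x) := by
  simp only [epm, PiLp.inner_apply, RCLike.inner_apply, conj_trivial]
  exact Finset.sum_congr rfl fun i _ => by ring

lemma quadSym_eq_inner (x : Eucl n) : quadSym ε x = inner ℝ x (epm ε x) := by
  simp only [quadSym, epm, PiLp.inner_apply, RCLike.inner_apply, conj_trivial]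
  exact Finset.sum_congr rfl fun i _ => by ring

lemma epm_add (x y : Eucl n) : epm ε (x + y) = epm ε x + epm ε y := by
  ext i
  simp [epm, mul_add]

lemma epm_smul (c : ℝ) (x : Eucl n) : epm ε (c • x) = c • epm ε x := by
  ext i
  simp [epm, mul_left_comm]

lemma hasFDerivAt_quadSym (x : Eucl n) :
    HasFDerivAt (quadSym ε) ((2 : ℝ) • innerSL ℝ (epm ε x)) x := by
  have h : HasFDerivAt (fun y : Eucl n => ∑ i, ε i * (y i) ^ 2)
      (∑ i, ε i • ((2 * x i) • (EuclideanSpace.proj i : Eucl n →L[ℝ] ℝ))) x := by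
    refine HasFDerivAt.fun_sum fun i _ => ?_
    have h1 : HasFDerivAt (fun y : Eucl n => y i) (EuclideanSpace.proj i : Eucl n →L[ℝ] ℝ) x :=
      (EuclideanSpace.proj i : Eucl n →L[ℝ] ℝ).hasFDerivAt
    simpa using (h1.pow 2).const_mul (ε i)
  have hderiv : (2 : ℝ) • innerSL ℝ (epm ε x) =
      ∑ i, ε i • ((2 * x i) • (EuclideanSpace.proj i : Eucl n →L[ℝ] ℝ)) := by
    ext1 y
    simp only [epm, smul_apply, innerSL_apply_apply, PiLp.inner_apply, RCLike.inner_apply,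
      conj_trivial, sum_apply, smul_eq_mul, PiLp.proj_apply, Finset.mul_sum]
    exact Finset.sum_congr rfl fun i _ => by ring
  rw [hderiv]
  exact h

lemma continuous_quadSym : Continuous (quadSym ε) :=
  continuous_iff_continuousAt.2 fun x => (hasFDerivAt_quadSym ε x).continuousAt

/-- The phase of the evolution restricted to translates of `P_e`: the `e`-component is the
time frequency and the remaining components are the negatives of those of `ξ`. -/
def slicePhase (e ξ : Eucl n) : Eucl n :=
  (quadSym ε ξ / (2 * Real.pi) + inner ℝ e ξ) • e - ξ

/-- The linear functional `ℓ` for which the derivative of `slicePhase` is `ℓ ⊗ e - 1`. -/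
def slicePhaseFunctional (e ξ : Eucl n) : Eucl n →L[ℝ] ℝ :=
  Real.pi⁻¹ • innerSL ℝ (epm ε ξ) + innerSL ℝ e

lemma hasFDerivAt_slicePhase (e ξ : Eucl n) :
    HasFDerivAt (slicePhase ε e)
      ((slicePhaseFunctional ε e ξ).smulRight e - ContinuousLinearMap.id ℝ (Eucl n)) ξ := by
  have h1 : HasFDerivAt (fun ζ => quadSym ε ζ / (2 * Real.pi) + inner ℝ e ζ)
      (slicePhaseFunctional ε e ξ) ξ := by
    have h := ((hasFDerivAt_quadSym ε ξ).mul_const (2 * Real.pi)⁻¹).add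
      (innerSL ℝ e).hasFDerivAt (x := ξ)
    have hderiv : slicePhaseFunctional ε e ξ =
        (2 * Real.pi)⁻¹ • (2 : ℝ) • innerSL ℝ (epm ε ξ) + innerSL ℝ e := by
      rw [slicePhaseFunctional, smul_smul, mul_inv, mul_right_comm, inv_mul_cancel₀ two_ne_zero,
        one_mul]
    rw [hderiv]
    exact h
  exact (h1.smul_const e).sub (hasFDerivAt_id ξ)

lemma abs_det_fderiv_slicePhase {e : Eucl n} (he : ‖e‖ = 1) (ξ : Eucl n) :
    |((slicePhaseFunctional ε e ξ).smulRight e - ContinuousLinearMap.id ℝ (Eucl n)).det|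
      = |inner ℝ ξ (epm ε e)| / Real.pi := by
  set ℓ := slicePhaseFunctional ε e ξ with hℓ
  have hlin : ((ℓ.smulRight e - ContinuousLinearMap.id ℝ (Eucl n) : Eucl n →L[ℝ] Eucl n) :
      Eucl n →ₗ[ℝ] Eucl n) = (-1 : ℝ) • LinearMap.transvection (-(ℓ : Eucl n →ₗ[ℝ] ℝ)) e := by
    ext1 y
    simp [LinearMap.transvection]
    abel
  have hval : 1 - ℓ e = -(inner ℝ ξ (epm ε e) / Real.pi) := by
    have : inner ℝ e e = (1 : ℝ) := by rw [real_inner_self_eq_norm_sq, he, one_pow]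
    simp only [hℓ, slicePhaseFunctional, add_apply, smul_apply, innerSL_apply_apply, smul_eq_mul, this]
    rw [real_inner_comm, inner_epm_comm]
    field_simp
    ring
  rw [ContinuousLinearMap.det, hlin, LinearMap.det_smul, LinearMap.transvection.det, abs_mul,
    abs_pow, abs_neg, abs_one, one_pow, one_mul, LinearMap.neg_apply,
    ContinuousLinearMap.coe_coe, ← sub_eq_add_neg, hval, abs_neg, abs_div,
    abs_of_pos Real.pi_pos]

lemma injOn_slicePhase {e : Eucl n} {s : Set (Eucl n)}
    (hs : ∀ x ∈ s, ∀ y ∈ s, inner ℝ x (epm ε e) + inner ℝ y (epm ε e) ≠ 0) (he : ‖e‖ = 1) :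
    s.InjOn (slicePhase ε e) := by
  intro x hx y hy hxy
  have hee : inner ℝ e e = (1 : ℝ) := by rw [real_inner_self_eq_norm_sq, he, one_pow]
  have hq : quadSym ε x = quadSym ε y := by
    have h := congrArg (fun z => inner ℝ e z) hxy
    simp only [slicePhase, inner_sub_right, inner_smul_right, hee, mul_one,
      add_sub_cancel_right] at h
    exact (div_left_inj' (by positivity)).1 h
  obtain ⟨c, rfl⟩ : ∃ c : ℝ, y = x + c • e := by
    refine ⟨inner ℝ e y - inner ℝ e x, ?_⟩
    simp only [slicePhase, hq] at hxy
    have h := congrArg (fun z => x + z + y -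
      (quadSym ε y / (2 * Real.pi) + inner ℝ e x) • e) hxy
    simp only [add_smul, sub_smul] at h ⊢
    convert h using 1 <;> abel
  have hc : c * (inner ℝ x (epm ε e) + inner ℝ (x + c • e) (epm ε e)) = 0 := by
    have := inner_epm_comm ε e x
    simp only [quadSym_eq_inner, epm_add, epm_smul, inner_add_left, inner_add_right,
      inner_smul_left, inner_smul_right, conj_trivial] at hq ⊢
    rw [this] at hq
    linarith
  rcases mul_eq_zero.1 hc with h | h
  · simp [h]
  · exact absurd h (hs _ hx _ hy)

lemma inner_slicePhase {e : Eucl n} (he : ‖e‖ = 1) (ξ : Eucl n) (t : ℝ) (w : hyperplane e) :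
    inner ℝ (slicePhase ε e ξ) (t • e + (w : Eucl n))
      = t * quadSym ε ξ / (2 * Real.pi) - inner ℝ ξ (w : Eucl n) := by
  have hee : inner ℝ e e = (1 : ℝ) := by rw [real_inner_self_eq_norm_sq, he, one_pow]
  have hew : inner ℝ e (w : Eucl n) = (0 : ℝ) := Submodule.mem_orthogonal_singleton_iff_inner_right.1 w.2
  simp only [slicePhase, inner_sub_left, inner_add_right, inner_smul_left, inner_smul_right,
    hee, hew, conj_trivial, real_inner_comm e ξ]
  ring

end Phase

section Smoothing

variable {n : ℕ} (ε : Fin n → ℝ)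

/-- The Fourier representation of a weighted wave packet on a set where the phase is
injective. -/
lemma exists_fourier_eq_slicePhase {e : Eucl n} (he : ‖e‖ = 1) {s : Set (Eucl n)}
    (hsm : MeasurableSet s)
    (hs : ∀ x ∈ s, ∀ y ∈ s, inner ℝ x (epm ε e) + inner ℝ y (epm ε e) ≠ 0)
    {g H : Eucl n → ℂ} (hH : Integrable H)
    (hHg : ∀ ξ, ‖H ξ‖ₑ ^ 2 = ENNReal.ofReal |inner ℝ ξ (epm ε e)| * ‖g ξ‖ₑ ^ 2) :
    ∃ F : Eucl n → ℂ, Integrable F ∧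
      (∀ z, 𝓕 F z = ∫ ξ in s, Real.fourierChar (-inner ℝ (slicePhase ε e ξ) z) • H ξ) ∧
      eLpNorm F 2 volume ≤ ENNReal.ofReal Real.pi ^ (1 / 2 : ℝ) * eLpNorm g 2 volume := by
  have hb : ∀ x ∈ s, 0 < |inner ℝ x (epm ε e)| := fun x hx =>
    abs_pos.2 fun h => hs x hx x hx (by rw [h, add_zero])
  obtain ⟨F, hF, hFz, hF2⟩ := exists_fourier_eq_oscillatory hsm
    (fun x _ => (hasFDerivAt_slicePhase ε e x).hasFDerivWithinAt) (injOn_slicePhase ε hs he)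
    (fun x hx => abs_pos.1 (by
      rw [abs_det_fderiv_slicePhase ε he]
      exact div_pos (hb x hx) Real.pi_pos)) hH.integrableOn
  refine ⟨F, hF, hFz, ?_⟩
  have hle : ∫⁻ y, ‖F y‖ₑ ^ 2 ≤ ENNReal.ofReal Real.pi * ∫⁻ ξ, ‖g ξ‖ₑ ^ 2 := by
    rw [hF2, ← lintegral_const_mul' _ _ ENNReal.ofReal_ne_top]
    refine le_trans (le_of_eq (setLIntegral_congr_fun hsm fun x hx => ?_))
      (setLIntegral_le_lintegral s _)
    have hb0 : ENNReal.ofReal |inner ℝ x (epm ε e)| ≠ 0 := (ENNReal.ofReal_pos.2 (hb x hx)).ne'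
    simp only [abs_det_fderiv_slicePhase ε he]
    rw [hHg, ENNReal.ofReal_div_of_pos Real.pi_pos, div_eq_mul_inv,
      ENNReal.inv_div (Or.inl ENNReal.ofReal_ne_top)
        (Or.inl (ENNReal.ofReal_pos.2 Real.pi_pos).ne'),
      div_eq_mul_inv, mul_comm, mul_assoc, ← mul_assoc _ _ (‖g x‖ₑ ^ 2),
      ENNReal.inv_mul_cancel hb0 ENNReal.ofReal_ne_top, one_mul]
  simp only [eLpNorm_eq_lintegral_rpow_enorm_toReal two_ne_zero ENNReal.ofNat_ne_top,
    ENNReal.toReal_ofNat, ENNReal.rpow_ofNat]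
  rw [← ENNReal.mul_rpow_of_nonneg _ _ (by norm_num)]
  gcongr

/-- The local smoothing estimate for the oscillatory integral with phase `slicePhase`. -/
lemma eLpNorm_integral_slicePhase_le {e : Eucl n} (he : ‖e‖ = 1)
    {g H : Eucl n → ℂ} (hH : Integrable H)
    (hHg : ∀ ξ, ‖H ξ‖ₑ ^ 2 = ENNReal.ofReal |inner ℝ ξ (epm ε e)| * ‖g ξ‖ₑ ^ 2) :
    AEStronglyMeasurable
        (fun z => ∫ ξ, Real.fourierChar (-inner ℝ (slicePhase ε e ξ) z) • H ξ) volume ∧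
      eLpNorm (fun z => ∫ ξ, Real.fourierChar (-inner ℝ (slicePhase ε e ξ) z) • H ξ) 2 volume
        ≤ 2 * ENNReal.ofReal Real.pi ^ (1 / 2 : ℝ) * eLpNorm g 2 volume := by
  have hcont : Continuous fun ξ : Eucl n => (inner ℝ ξ (epm ε e) : ℝ) := by fun_prop
  have hpos : MeasurableSet {ξ : Eucl n | 0 < (inner ℝ ξ (epm ε e) : ℝ)} :=
    (isOpen_lt continuous_const hcont).measurableSet
  have hneg : MeasurableSet {ξ : Eucl n | (inner ℝ ξ (epm ε e) : ℝ) < 0} :=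
    (isOpen_lt hcont continuous_const).measurableSet
  obtain ⟨F, hF, hFz, hF2⟩ := exists_fourier_eq_slicePhase ε he hpos
    (fun x hx y hy => (add_pos hx hy).ne') hH hHg
  obtain ⟨G, hG, hGz, hG2⟩ := exists_fourier_eq_slicePhase ε he hneg
    (fun x hx y hy => (add_neg hx hy).ne) hH hHg
  have hsum : (fun z => ∫ ξ, Real.fourierChar (-inner ℝ (slicePhase ε e ξ) z) • H ξ)
      = 𝓕 F + 𝓕 G := by
    funext z
    have hphase : Continuous fun ξ => -inner ℝ (slicePhase ε e ξ) z := by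
      have := continuous_quadSym ε
      unfold slicePhase
      fun_prop
    have hint : Integrable fun ξ => Real.fourierChar (-inner ℝ (slicePhase ε e ξ) z) • H ξ := by
      refine hH.mono ?_ (Eventually.of_forall fun ξ => by simp)
      exact (Real.continuous_fourierChar.comp hphase).aestronglyMeasurable.smul hH.1
    have hdisj : Disjoint {ξ : Eucl n | 0 < (inner ℝ ξ (epm ε e) : ℝ)}
        {ξ : Eucl n | (inner ℝ ξ (epm ε e) : ℝ) < 0} :=
      Set.disjoint_left.2 fun _ h₁ h₂ => lt_asymm (Set.mem_ofPred.1 h₁) (Set.mem_ofPred.1 h₂)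
    rw [Pi.add_apply, hFz, hGz, ← setIntegral_union hdisj hneg hint.integrableOn
      hint.integrableOn, setIntegral_eq_integral_of_forall_compl_eq_zero]
    intro ξ hξ
    have h0 : (inner ℝ ξ (epm ε e) : ℝ) = 0 := by
      simp only [Set.mem_union, Set.mem_ofPred_eq, not_or, not_lt] at hξ
      exact le_antisymm hξ.1 hξ.2
    have hHξ := hHg ξ
    rw [h0, abs_zero, ENNReal.ofReal_zero, zero_mul] at hHξ
    rw [enorm_eq_zero.1 (pow_eq_zero_iff two_ne_zero |>.1 hHξ), smul_zero]
  have hFc := (continuous_fourier_of_integrable hF).aestronglyMeasurable (μ := volume)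
  have hGc := (continuous_fourier_of_integrable hG).aestronglyMeasurable (μ := volume)
  rw [hsum]
  refine ⟨hFc.add hGc, (eLpNorm_add_le hFc hGc one_le_two).trans ?_⟩
  rw [mul_assoc, two_mul]
  exact add_le_add ((eLpNorm_fourier_le hF).trans hF2) ((eLpNorm_fourier_le hG).trans hG2)

/-- The smoothing estimate on the affine hyperplane `r • e + P_e` for initial data with
Fourier transform `g`. -/
lemma eLpNorm_slice_le {e : Eucl n} (he : ‖e‖ = 1) {g : Eucl n → ℂ}
    (hg : Integrable fun ξ => ((Real.sqrt |inner ℝ ξ (epm ε e)| : ℝ) : ℂ) * g ξ) (r : ℝ) :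
    eLpNorm (fun tv : ℝ × hyperplane e =>
        𝓕⁻ (fun ξ => ((Real.sqrt |inner ℝ ξ (epm ε e)| : ℝ) : ℂ) *
          (Complex.exp (-Complex.I * tv.1 * quadSym ε ξ) * g ξ)) (r • e + (tv.2 : Eucl n)))
        2 volume
      ≤ 2 * ENNReal.ofReal Real.pi ^ (1 / 2 : ℝ) * eLpNorm g 2 volume := by
  let H : Eucl n → ℂ := fun ξ => Real.fourierChar (r * inner ℝ ξ e) •
    (((Real.sqrt |inner ℝ ξ (epm ε e)| : ℝ) : ℂ) * g ξ)
  have hH : Integrable H := by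
    refine hg.mono ?_ (Eventually.of_forall fun ξ => by simp [H])
    exact (Real.continuous_fourierChar.comp (by fun_prop)).aestronglyMeasurable.smul hg.1
  have hHg : ∀ ξ, ‖H ξ‖ₑ ^ 2 = ENNReal.ofReal |inner ℝ ξ (epm ε e)| * ‖g ξ‖ₑ ^ 2 := fun ξ => by
    have h1 : ‖H ξ‖ₑ = ‖Real.sqrt |inner ℝ ξ (epm ε e)|‖ₑ * ‖g ξ‖ₑ := by
      rw [← enorm_norm (H ξ), Circle.norm_smul, enorm_norm, enorm_mul,
        ← enorm_norm ((Real.sqrt _ : ℝ) : ℂ), Complex.norm_real, enorm_norm]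
    rw [h1, mul_pow, Real.enorm_of_nonneg (Real.sqrt_nonneg _),
      ← ENNReal.ofReal_pow (Real.sqrt_nonneg _), Real.sq_sqrt (abs_nonneg _)]
  obtain ⟨hmeas, hle⟩ := eLpNorm_integral_slicePhase_le ε he hH hHg
  have hmp := measurePreserving_smul_add_hyperplane he
  rw [← eLpNorm_comp_measurePreserving hmeas hmp] at hle
  convert hle using 2
  funext tv
  rw [Function.comp_apply, Real.fourierInv_eq]
  refine integral_congr_ae (Eventually.of_forall fun ξ => ?_)
  simp only [H]
  rw [inner_slicePhase ε he]
  simp only [Circle.smul_def, Real.fourierChar_apply, smul_eq_mul, inner_add_right,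
    inner_smul_right]
  have hexp : Complex.exp (↑(2 * Real.pi * (r * inner ℝ ξ e + inner ℝ ξ (tv.2 : Eucl n))) * I) *
      Complex.exp (-I * tv.1 * quadSym ε ξ) =
      Complex.exp (↑(2 * Real.pi * -(tv.1 * quadSym ε ξ / (2 * Real.pi) -
        inner ℝ ξ (tv.2 : Eucl n))) * I) *
      Complex.exp (↑(2 * Real.pi * (r * inner ℝ ξ e)) * I) := by
    rw [← Complex.exp_add, ← Complex.exp_add]
    congr 1
    have := Complex.ofReal_ne_zero.2 Real.pi_ne_zero
    push_cast
    field_simp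
    ring
  linear_combination ((Real.sqrt |inner ℝ ξ (epm ε e)| : ℝ) : ℂ) * g ξ * hexp

/-- A multiplier annihilates functions whose Fourier integral vanishes identically. -/
lemma mulOp_eq_zero_of_fourier_eq_zero (m : Eucl n → ℂ) {f : Eucl n → ℂ} (hf : 𝓕 f = 0) :
    mulOp m f = 0 := by
  funext x
  rw [mulOp, hf, Real.fourierInv_eq]
  simp

/-- Composing a multiplier with the propagator multiplies the symbols, except where the literal
Fourier integrals degenerate and the composition vanishes. -/
lemma mulOp_prop_eq_zero_or (m : Eucl n → ℂ) (φ : Eucl n → ℂ) (t : ℝ) :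
    mulOp m (prop ε t φ) = 0 ∨ mulOp m (prop ε t φ) =
      𝓕⁻ (fun ξ => m ξ * (Complex.exp (-Complex.I * t * quadSym ε ξ) * 𝓕 φ ξ)) := by
  have hzero (h : prop ε t φ = 0) : mulOp m (prop ε t φ) = 0 := by
    refine mulOp_eq_zero_of_fourier_eq_zero m ?_
    funext x
    rw [h, Real.fourier_eq]
    simp
  by_cases hφ : Integrable φ
  swap
  · exact Or.inl (hzero (mulOp_eq_zero_of_fourier_eq_zero _
      (fourier_eq_zero_of_not_integrable hφ)))
  by_cases hp : Integrable (prop ε t φ)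
  swap
  · exact Or.inl (mulOp_eq_zero_of_fourier_eq_zero m (fourier_eq_zero_of_not_integrable hp))
  let g : Eucl n → ℂ := fun ξ => Complex.exp (-Complex.I * t * quadSym ε ξ) * 𝓕 φ ξ
  have hpg : prop ε t φ = 𝓕⁻ g := rfl
  by_cases hgi : Integrable g
  swap
  · exact Or.inl (hzero (hpg.trans (fourierInv_eq_zero_of_not_integrable hgi)))
  right
  have hgc : Continuous g := by
    have h1 := continuous_quadSym ε
    have h2 := continuous_fourier_of_integrable hφ
    exact (Complex.continuous_exp.comp (by fun_prop)).mul h2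
  have hFg : Integrable (𝓕 g) := by
    have h : Integrable fun x => 𝓕⁻ g (-x) := (hpg ▸ hp).comp_neg
    simpa only [Real.fourierInv_eq_fourier_neg, neg_neg] using h
  rw [mulOp, hpg, hgc.fourier_fourierInv_eq hgi hFg]

/-- If the multiplier applied to `φ` is not represented by a convergent Fourier integral, then
neither is its evolution. -/
lemma mulOp_prop_eq_zero_of_not_integrable {m : Eucl n → ℂ} (hm : Continuous m)
    {φ : Eucl n → ℂ} (h : ¬ Integrable fun ξ => m ξ * 𝓕 φ ξ) (t : ℝ) :
    mulOp m (prop ε t φ) = 0 := by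
  rcases mulOp_prop_eq_zero_or ε m φ t with h0 | h0
  · exact h0
  rw [h0]
  refine fourierInv_eq_zero_of_not_integrable fun hi => h ?_
  have hφ : Continuous (𝓕 φ) := by
    by_cases hφ : Integrable φ
    · exact continuous_fourier_of_integrable hφ
    · rw [fourier_eq_zero_of_not_integrable hφ]
      exact continuous_const
  refine hi.mono (hm.mul hφ).aestronglyMeasurable (Eventually.of_forall fun ξ => ?_)
  have hexp : ‖Complex.exp (-Complex.I * t * quadSym ε ξ)‖ = 1 := by
    have : -Complex.I * t * quadSym ε ξ = ((-(t * quadSym ε ξ) : ℝ) : ℂ) * Complex.I := by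
      push_cast
      ring
    rw [this, Complex.norm_exp_ofReal_mul_I]
  rw [norm_mul, norm_mul, norm_mul, hexp, one_mul]

/-- The fixed-slice form of the smoothing effect. -/
lemma innerQ_smoothing_le {e : Eucl n} (he : ‖e‖ = 1) (φ : Eucl n → ℂ) (r : ℝ) :
    innerQ 2 e (fun p : ℝ × Eucl n =>
        mulOp (fun ξ => ((Real.sqrt |(inner ℝ ξ (epm ε e) : ℝ)| : ℝ) : ℂ))
          (prop ε p.1 φ) p.2) r
      ≤ 2 * ENNReal.ofReal Real.pi ^ (1 / 2 : ℝ) * eLpNorm φ 2 volume := by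
  set m : Eucl n → ℂ := fun ξ => ((Real.sqrt |(inner ℝ ξ (epm ε e) : ℝ)| : ℝ) : ℂ) with hm
  have hmc : Continuous m := by fun_prop
  have hzero (h : ∀ t, mulOp m (prop ε t φ) = 0) :
      innerQ 2 e (fun p : ℝ × Eucl n => mulOp m (prop ε p.1 φ) p.2) r
        ≤ 2 * ENNReal.ofReal Real.pi ^ (1 / 2 : ℝ) * eLpNorm φ 2 volume := by
    simp [innerQ, h]
  by_cases hint : Integrable fun ξ => m ξ * 𝓕 φ ξ
  swap
  · exact hzero fun t => mulOp_prop_eq_zero_of_not_integrable ε hmc hint t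
  have hφle : eLpNorm (𝓕 φ) 2 volume ≤ eLpNorm φ 2 volume := by
    by_cases hφ : Integrable φ
    · exact eLpNorm_fourier_le hφ
    · simp [fourier_eq_zero_of_not_integrable hφ]
  refine (eLpNorm_mono fun tv => ?_).trans
    ((eLpNorm_slice_le ε he hint r).trans (by gcongr))
  rcases mulOp_prop_eq_zero_or ε m φ tv.1 with h0 | h0
  · simp [h0]
  · exact (congrArg norm (congrFun h0 _)).le

end Smoothing

end DNLS

/-- Smoothing effect `‖D^{1/2}_{e_±} W_±(t)φ‖_{L^{∞,2}_e} ≤ C‖φ‖_{L²}`. -/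
theorem smoothing_effect
    (n : ℕ) (hn : 2 ≤ n) (ε : Fin n → ℝ) (hε : ∀ i, ε i = 1 ∨ ε i = -1) :
    ∃ C : ℝ, 0 < C ∧ ∀ (e : Eucl n), ‖e‖ = 1 → ∀ φ : Eucl n → ℂ, MemLp φ 2 volume →
      aniNorm ∞ 2 e
        (fun p : ℝ × Eucl n =>
          mulOp (fun ξ => ((Real.sqrt |(inner ℝ ξ (epm ε e) : ℝ)| : ℝ) : ℂ))
            (prop ε p.1 φ) p.2)
      ≤ ENNReal.ofReal C * eLpNorm φ 2 volume := by
  refine ⟨2 * Real.pi ^ (1 / 2 : ℝ), by positivity, fun e he φ _ => ?_⟩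
  rw [ENNReal.ofReal_mul zero_le_two, ENNReal.ofReal_ofNat,
    ← ENNReal.ofReal_rpow_of_pos Real.pi_pos, aniNorm, if_pos rfl]
  exact essSup_le_of_ae_le _ (Eventually.of_forall (innerQ_smoothing_le ε he φ))
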